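/- Let k ≥ 2 and 2 ≤ j ≤ k, and let 0 < p < p̃. Then there exists a constant λ ≥ 1, independent of the depth n, such that for every n ≥ 0 and every f : Ω_n → ℝ, Var_μ(f) ≤ λ · ∑_{x ∈ V_n} μ( c̄_x · Var_x(f) ), where c̄_x(η) = 1 if x is a leaf (has depth n) and otherwise c̄_x(η) = 1 if and only if at least j children y of x satisfy η_y = 0. (Equivalently: the spectral gap of the oriented FA-jf model on finite rooted k-ary trees with unconstrained leaves is bounded away from 0 uniformly in the depth, for any p below the critical density p̃.) -/

import Mathlib

open scoped Classical

noncomputable section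

/-- The bootstrap recursion map `g_p(x) = p·∑_{i=k-j+1}^{k} C(k,i) xⁱ (1-x)^{k-i}`. -/
def g (k j : ℕ) (p x : ℝ) : ℝ :=
  p * ∑ i ∈ Finset.Icc (k - j + 1) k, (Nat.choose k i : ℝ) * x ^ i * (1 - x) ^ (k - i)

/-- The critical threshold `p̃`: the supremum of the densities `p ∈ [0,1]` for which
`x = 0` is the unique fixed point of `g_p` in `[0,1]`. -/
def ptilde (k j : ℕ) : ℝ :=
  sSup {p : ℝ | p ∈ Set.Icc (0 : ℝ) 1 ∧ ∀ x ∈ Set.Icc (0 : ℝ) 1, g k j p x = x → x = 0}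

section Bernoulli

variable {V : Type*} [Fintype V] [DecidableEq V]

/-- Bernoulli(p) product weight of a configuration (`true` = occupied, with probability `p`). -/
def wt (p : ℝ) (η : V → Bool) : ℝ := ∏ x : V, if η x then p else 1 - p

/-- Expectation under the Bernoulli(p) product measure μ. -/
def mean (p : ℝ) (f : (V → Bool) → ℝ) : ℝ := ∑ η : V → Bool, wt p η * f η

/-- Probability of an event under the Bernoulli(p) product measure μ. -/
def probEv (p : ℝ) (E : (V → Bool) → Prop) : ℝ := mean p (fun η => if E η then 1 else 0)

/-- Conditional expectation `μ_A(f)` of `f` given the coordinates outside `A`. -/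
def cexp (p : ℝ) (A : Finset V) (f : (V → Bool) → ℝ) (η : V → Bool) : ℝ :=
  ∑ ζ : V → Bool,
    (∏ x : V, if x ∈ A then (if ζ x then p else 1 - p) else (if ζ x = η x then 1 else 0)) * f ζ

/-- Conditional variance `Var_A(f)` on the coordinates of `A` given the remaining coordinates. -/
def cvar (p : ℝ) (A : Finset V) (f : (V → Bool) → ℝ) (η : V → Bool) : ℝ :=
  cexp p A (fun ζ => f ζ ^ 2) η - (cexp p A f η) ^ 2

/-- Variance `Var_μ(f)` under the Bernoulli(p) product measure. -/
def varTot (p : ℝ) (f : (V → Bool) → ℝ) : ℝ := mean p (fun η => f η ^ 2) - (mean p f) ^ 2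

end Bernoulli

/-- Vertices of the rooted `k`-ary tree of depth `n`: words of length `≤ n` over `Fin k`. -/
abbrev TV (k n : ℕ) := Σ m : Fin (n + 1), Fin m.val → Fin k

/-- The root: the empty word. -/
def rootT (k n : ℕ) : TV k n := ⟨⟨0, Nat.succ_pos n⟩, Fin.elim0⟩

/-- `y` is a child of `x` in the rooted tree. -/
def childOf {k n : ℕ} (x y : TV k n) : Prop :=
  ∃ h : y.1.val = x.1.val + 1, ∀ i : Fin x.1.val, y.2 (Fin.cast h.symm i.castSucc) = x.2 i

/-- The oriented bootstrap map `B̄`: a vertex becomes empty iff it is already empty or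
at least `j` of its children are empty. -/
def bootO {k n : ℕ} (j : ℕ) (η : TV k n → Bool) : TV k n → Bool := fun x =>
  if η x = false ∨ j ≤ (Finset.univ.filter fun y : TV k n => childOf x y ∧ η y = false).card
  then false else true

/-- The oriented FA-jf constraint with unconstrained leaves: `c̄_x(η) = 1` iff `x` is a leaf
(depth `n`) or at least `j` children of `x` are empty. -/
def cbar {k n : ℕ} (j : ℕ) (x : TV k n) (η : TV k n → Bool) : ℝ :=
  if x.1.val = n then 1
  else if j ≤ (Finset.univ.filter fun y : TV k n => childOf x y ∧ η y = false).card then 1 else 0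


section Averages

variable {V : Type*} [Fintype V] [DecidableEq V] {p : ℝ}

theorem cexp_cexp (A B : Finset V) (f : (V → Bool) → ℝ) :
    cexp p A (cexp p B f) = cexp p (A ∪ B) f := by
  funext η
  simp only [cexp, Finset.mul_sum, ← mul_assoc, ← Finset.prod_mul_distrib]
  rw [Finset.sum_comm]
  refine Finset.sum_congr rfl fun ξ _ => ?_
  rw [← Finset.sum_mul]
  congr 1
  have h := Finset.prod_univ_sum (fun _ : V => (Finset.univ : Finset Bool)) (fun x b =>
    (if x ∈ A then (if b then p else 1 - p) else (if b = η x then 1 else 0)) *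
    (if x ∈ B then (if ξ x then p else 1 - p) else (if ξ x = b then 1 else 0)))
  rw [Fintype.piFinset_univ] at h
  rw [← h]
  refine Finset.prod_congr rfl fun x _ => ?_
  by_cases hA : x ∈ A <;> by_cases hB : x ∈ B <;> cases η x <;> cases ξ x <;> simp [hA, hB] <;> ring

theorem mean_cexp_mul (A : Finset V) (f u : (V → Bool) → ℝ) :
    mean p (fun η => cexp p A f η * u η) = mean p (fun η => f η * cexp p A u η) := by
  simp only [mean, cexp, Finset.mul_sum, Finset.sum_mul]
  rw [Finset.sum_comm]
  refine Finset.sum_congr rfl fun ζ _ => Finset.sum_congr rfl fun η _ => ?_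
  have h : wt p η * (∏ x : V, if x ∈ A then (if ζ x then p else 1 - p)
        else (if ζ x = η x then 1 else 0)) =
      wt p ζ * (∏ x : V, if x ∈ A then (if η x then p else 1 - p)
        else (if η x = ζ x then 1 else 0)) := by
    simp only [wt, ← Finset.prod_mul_distrib]
    refine Finset.prod_congr rfl fun x _ => ?_
    by_cases hA : x ∈ A <;> cases η x <;> cases ζ x <;> simp [hA, mul_comm]
  linear_combination (f ζ * u η) * h

theorem cexp_one (A : Finset V) (η : V → Bool) : cexp p A (fun _ => 1) η = 1 := by
  simp only [cexp, mul_one]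
  have h := Finset.prod_univ_sum (fun _ : V => (Finset.univ : Finset Bool)) (fun x b =>
    (if x ∈ A then (if b then p else 1 - p) else (if b = η x then (1 : ℝ) else 0)))
  rw [Fintype.piFinset_univ] at h
  rw [← h]
  refine Finset.prod_eq_one fun x _ => ?_
  by_cases hA : x ∈ A <;> cases η x <;> simp [hA]

theorem cexp_mul_of_indep {A : Finset V} {u : (V → Bool) → ℝ}
    (hu : ∀ η ζ : V → Bool, (∀ x ∉ A, η x = ζ x) → u η = u ζ) (f : (V → Bool) → ℝ) :
    cexp p A (fun η => u η * f η) = fun η => u η * cexp p A f η := by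
  funext η
  simp only [cexp, Finset.mul_sum]
  refine Finset.sum_congr rfl fun ζ _ => ?_
  by_cases h : ∀ x ∉ A, η x = ζ x
  · rw [hu η ζ h]; ring
  · push Not at h
    obtain ⟨x, hx, hne⟩ := h
    rw [Finset.prod_eq_zero (Finset.mem_univ x) (by simp [hx, hne.symm])]
    simp

theorem cexp_of_indep {A : Finset V} {u : (V → Bool) → ℝ}
    (hu : ∀ η ζ : V → Bool, (∀ x ∉ A, η x = ζ x) → u η = u ζ) : cexp p A u = u := by
  have h := cexp_mul_of_indep (p := p) hu (fun _ => 1)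
  simpa [cexp_one] using h

theorem cexp_congr_right (A : Finset V) (f : (V → Bool) → ℝ) {η ζ : V → Bool}
    (h : ∀ x ∉ A, η x = ζ x) : cexp p A f η = cexp p A f ζ := by
  simp only [cexp]
  refine Finset.sum_congr rfl fun ξ _ => ?_
  congr 1
  refine Finset.prod_congr rfl fun x _ => ?_
  by_cases hx : x ∈ A
  · simp [hx]
  · simp [hx, h x hx]

theorem cexp_univ (f : (V → Bool) → ℝ) (η : V → Bool) :
    cexp p Finset.univ f η = mean p f := by
  simp [cexp, mean, wt]

theorem cexp_empty (f : (V → Bool) → ℝ) : cexp p ∅ f = f :=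
  cexp_of_indep fun _ _ h => congrArg f (funext fun x => h x (Finset.notMem_empty x))

theorem mean_cexp (A : Finset V) (f : (V → Bool) → ℝ) : mean p (cexp p A f) = mean p f := by
  simpa [cexp_one] using mean_cexp_mul (p := p) A f (fun _ => 1)

theorem cexp_sub (A : Finset V) (f u : (V → Bool) → ℝ) :
    cexp p A (fun η => f η - u η) = fun η => cexp p A f η - cexp p A u η := by
  funext η; simp [cexp, mul_sub]

theorem cexp_add (A : Finset V) (f u : (V → Bool) → ℝ) :
    cexp p A (fun η => f η + u η) = fun η => cexp p A f η + cexp p A u η := by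
  funext η; simp [cexp, mul_add, Finset.sum_add_distrib]

theorem mean_add (f u : (V → Bool) → ℝ) :
    mean p (fun η => f η + u η) = mean p f + mean p u := by
  simp [mean, mul_add, Finset.sum_add_distrib]

theorem mean_sub (f u : (V → Bool) → ℝ) :
    mean p (fun η => f η - u η) = mean p f - mean p u := by
  simp [mean, mul_sub]

theorem mean_const_mul (a : ℝ) (f : (V → Bool) → ℝ) :
    mean p (fun η => a * f η) = a * mean p f := by
  simp only [mean, Finset.mul_sum]
  exact Finset.sum_congr rfl fun _ _ => by ring

theorem mean_sum {ι : Type*} (s : Finset ι) (F : ι → (V → Bool) → ℝ) :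
    mean p (fun η => ∑ i ∈ s, F i η) = ∑ i ∈ s, mean p (F i) := by
  simp only [mean, Finset.mul_sum]
  exact Finset.sum_comm

theorem mean_const (a : ℝ) : mean p (fun _ : V → Bool => a) = a := by
  rw [← cexp_univ (V := V) _ (fun _ => true)]
  exact congrFun (cexp_of_indep (A := Finset.univ) (u := fun _ : V → Bool => a)
    fun _ _ _ => rfl) _

theorem cexp_eq_mean {A B : Finset V} (hBA : B ⊆ A) {u : (V → Bool) → ℝ}
    (hu : ∀ η ζ : V → Bool, (∀ x ∈ B, η x = ζ x) → u η = u ζ) (η : V → Bool) :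
    cexp p A u η = mean p u := by
  have h1 : cexp p Aᶜ u = u :=
    cexp_of_indep fun η ζ h => hu η ζ fun x hx => h x (by simpa using hBA hx)
  rw [← h1, cexp_cexp, Finset.union_compl, cexp_univ, h1]

theorem mean_mul_of_disjoint {A B : Finset V} (hAB : Disjoint A B) {u v : (V → Bool) → ℝ}
    (hu : ∀ η ζ : V → Bool, (∀ x ∈ A, η x = ζ x) → u η = u ζ)
    (hv : ∀ η ζ : V → Bool, (∀ x ∈ B, η x = ζ x) → v η = v ζ) :
    mean p (fun η => u η * v η) = mean p u * mean p v := by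
  have hcu : cexp p A u = fun _ => mean p u := funext (cexp_eq_mean subset_rfl hu)
  rw [← mean_cexp A]
  have h2 : cexp p A (fun η => u η * v η) = fun η => v η * cexp p A u η := by
    simp only [mul_comm (u _)]
    exact cexp_mul_of_indep (fun η ζ h => hv η ζ fun x hx =>
      h x (Finset.disjoint_right.1 hAB hx)) u
  rw [h2, hcu]
  simp only [mul_comm (v _)]
  rw [mean_const_mul]

variable (hp0 : 0 ≤ p) (hp1 : p ≤ 1)
include hp0 hp1

theorem cexp_mono (A : Finset V) {f u : (V → Bool) → ℝ} (h : ∀ η, f η ≤ u η) (η : V → Bool) :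
    cexp p A f η ≤ cexp p A u η := by
  refine Finset.sum_le_sum fun ζ _ => mul_le_mul_of_nonneg_left (h ζ) ?_
  refine Finset.prod_nonneg fun x _ => ?_
  split_ifs <;> linarith

theorem mean_mono {f u : (V → Bool) → ℝ} (h : ∀ η, f η ≤ u η) : mean p f ≤ mean p u := by
  simpa only [cexp_univ] using cexp_mono hp0 hp1 Finset.univ h (fun _ => true)

theorem mean_nonneg {f : (V → Bool) → ℝ} (h : ∀ η, 0 ≤ f η) : 0 ≤ mean p f := by
  simpa [mean_const] using mean_mono hp0 hp1 (f := fun _ => 0) h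

theorem cexp_mul_sq_le (A : Finset V) (u v : (V → Bool) → ℝ) (η : V → Bool) :
    cexp p A (fun ζ => u ζ * v ζ) η ^ 2 ≤
      cexp p A (fun ζ => u ζ ^ 2) η * cexp p A (fun ζ => v ζ ^ 2) η := by
  have hw : ∀ ζ : V → Bool, 0 ≤ ∏ x : V, if x ∈ A then (if ζ x then p else 1 - p)
      else (if ζ x = η x then 1 else 0) := fun ζ => Finset.prod_nonneg fun x _ => by
    split_ifs <;> linarith
  exact Finset.sum_sq_le_sum_mul_sum_of_sq_le_mul _
    (fun ζ _ => mul_nonneg (hw ζ) (sq_nonneg _)) (fun ζ _ => mul_nonneg (hw ζ) (sq_nonneg _))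
    (fun ζ _ => le_of_eq (by ring))

theorem mean_cexp_sq_le (A : Finset V) (f : (V → Bool) → ℝ) :
    mean p (fun η => cexp p A f η ^ 2) ≤ mean p (fun η => f η ^ 2) := by
  rw [← mean_cexp A (fun η => f η ^ 2)]
  refine mean_mono hp0 hp1 fun η => ?_
  simpa [cexp_one] using cexp_mul_sq_le hp0 hp1 A (fun _ => 1) f η

omit hp0 hp1 in
theorem mean_cexp_sub_sq {W S : Finset V} (h : W ⊆ S) (f : (V → Bool) → ℝ) :
    mean p (fun η => (cexp p W f η - cexp p S f η) ^ 2) =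
      mean p (fun η => cexp p W f η ^ 2) - mean p (fun η => cexp p S f η ^ 2) := by
  have h1 : mean p (fun η => cexp p W f η * cexp p S f η) =
      mean p (fun η => cexp p S f η ^ 2) := by
    rw [mean_cexp_mul, cexp_cexp, Finset.union_eq_right.2 h]
    simp only [sq]
    rw [mean_cexp_mul, cexp_cexp, Finset.union_idempotent]
  have h2 : (fun η => (cexp p W f η - cexp p S f η) ^ 2) = fun η =>
      (cexp p W f η ^ 2 + cexp p S f η ^ 2) - 2 * (cexp p W f η * cexp p S f η) := by
    funext η; ring
  rw [h2, mean_sub, mean_add, mean_const_mul, h1]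
  ring

/-- The coordinates which lie strictly deeper than `x`. -/
def deeper (d : V → ℕ) (x : V) : Finset V := Finset.univ.filter fun z => d x < d z

/-- The mean conditional variance at `x` of the average of `f` over all deeper vertices. -/
def levelVar (p : ℝ) (d : V → ℕ) (f : (V → Bool) → ℝ) (x : V) : ℝ :=
  mean p (fun η => (cexp p (deeper d x) f η - cexp p (insert x (deeper d x)) f η) ^ 2)

theorem mean_cexp_sub_sq_le_sum_levelVar (d : V → ℕ) (f : (V → Bool) → ℝ) (A : Finset V) :
    ∀ W : Finset V, (∀ y ∈ A, ∀ z, d y < d z → z ∈ A ∪ W) →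
    mean p (fun η => (cexp p W f η - cexp p (A ∪ W) f η) ^ 2) ≤
      ∑ y ∈ A, levelVar p d f y := by
  induction A using Finset.induction_on_max_value d with
  | empty => intro W _; simp [mean_const]
  | insert a s has hmax ih =>
    intro W hW
    have hD : deeper d a ⊆ W := fun z hz => by
      have hz' : d a < d z := by simpa [deeper] using hz
      rcases Finset.mem_union.1 (hW a (Finset.mem_insert_self _ _) z hz') with h | h
      · rcases Finset.mem_insert.1 h with rfl | h
        · omega
        · exact absurd (hmax z h) (by omega)
      · exact h
    have key := ih (insert a W) fun y hy z hz => by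
      have := hW y (Finset.mem_insert_of_mem hy) z hz
      simp only [Finset.mem_union, Finset.mem_insert] at this ⊢
      tauto
    have e : s ∪ insert a W = insert a s ∪ W := by
      rw [Finset.union_insert, Finset.insert_union]
    rw [e, mean_cexp_sub_sq (by rw [← e]; exact Finset.subset_union_right)] at key
    rw [Finset.sum_insert has, mean_cexp_sub_sq Finset.subset_union_right]
    have h1 : mean p (fun η => (cexp p W f η - cexp p (insert a W) f η) ^ 2) ≤
        levelVar p d f a := by
      refine le_trans (le_of_eq ?_) (mean_cexp_sq_le hp0 hp1 W _)
      rw [cexp_sub, cexp_cexp, cexp_cexp, Finset.union_eq_left.2 hD, Finset.union_insert,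
        Finset.union_eq_left.2 hD]
    rw [mean_cexp_sub_sq (Finset.subset_insert _ _)] at h1
    linarith

theorem varTot_le_sum_levelVar (d : V → ℕ) (f : (V → Bool) → ℝ) :
    varTot p f ≤ ∑ y, levelVar p d f y := by
  refine le_trans (le_of_eq ?_)
    (mean_cexp_sub_sq_le_sum_levelVar hp0 hp1 d f Finset.univ ∅ (by simp))
  rw [mean_cexp_sub_sq (Finset.empty_subset _), cexp_empty, Finset.union_empty]
  simp only [cexp_univ, mean_const, varTot]

omit hp0 hp1 in
theorem mean_mul_cvar {u : (V → Bool) → ℝ} {A : Finset V}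
    (hu : ∀ η ζ : V → Bool, (∀ z ∉ A, η z = ζ z) → u η = u ζ) (f : (V → Bool) → ℝ) :
    mean p (fun η => u η * cvar p A f η) =
      mean p (fun η => u η * (f η - cexp p A f η) ^ 2) := by
  rw [← mean_cexp A (fun η => u η * (f η - cexp p A f η) ^ 2), cexp_mul_of_indep hu]
  congr 1
  funext η
  congr 1
  have h2 : (fun η => (f η - cexp p A f η) ^ 2) = fun η =>
      f η ^ 2 - (cexp p A f η * (2 * f η - cexp p A f η)) := by
    funext η; ring
  rw [h2, cexp_sub, cexp_mul_of_indep fun η ζ h => cexp_congr_right A f h, cexp_sub, cexp_cexp,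
    Finset.union_idempotent]
  have h3 : cexp p A (fun η => 2 * f η) = fun η => 2 * cexp p A f η :=
    cexp_mul_of_indep (u := fun _ => 2) (fun _ _ _ => rfl) f
  simp only [h3, cvar]
  ring

/-- One step of the comparison: the unconstrained local variance at `x` is bounded by the
constrained one, up to a small multiple of the local variances in the block `B` which determines
the constraint. -/
theorem levelVar_le (d : V → ℕ) (f : (V → Bool) → ℝ) (x : V) (B : Finset V)
    (hB : ∀ z ∈ B, d x < d z) (P : (V → Bool) → Prop)
    (hP : ∀ η ζ : V → Bool, (∀ z ∈ B, η z = ζ z) → (P η ↔ P ζ)) :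
    levelVar p d f x ≤ 2 * mean p (fun η => (if P η then 1 else 0) * cvar p {x} f η) +
      2 * mean p (fun η => if P η then 0 else 1) * ∑ y ∈ insert x B, levelVar p d f y := by
  set D : Finset V := deeper d x with hD
  have hBD : B ⊆ D := fun z hz => by simpa [hD, deeper] using hB z hz
  have hxD : x ∉ D := by simp [hD, deeper]
  have hxB : x ∉ B := fun h => hxD (hBD h)
  set c : (V → Bool) → ℝ := fun η => if P η then 1 else 0 with hc
  set c' : (V → Bool) → ℝ := fun η => if P η then 0 else 1 with hc'
  have hcB : ∀ η ζ : V → Bool, (∀ z ∈ B, η z = ζ z) → c η = c ζ := fun η ζ h => by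
    simp only [hc, hP η ζ h]
  have hcB' : ∀ η ζ : V → Bool, (∀ z ∈ B, η z = ζ z) → c' η = c' ζ := fun η ζ h => by
    simp only [hc', hP η ζ h]
  have hsq : ∀ η, c η ^ 2 = c η := fun η => by simp only [hc]; split_ifs <;> simp
  have hsq' : ∀ η, c' η ^ 2 = c' η := fun η => by simp only [hc']; split_ifs <;> simp
  have hcc : ∀ η, c η + c' η = 1 := fun η => by simp only [hc, hc']; split_ifs <;> simp
  set g₀ : (V → Bool) → ℝ := cexp p (D \ B) f with hg₀
  set m₀ : (V → Bool) → ℝ := cexp p (insert x D) f with hm₀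
  set u : (V → Bool) → ℝ := cexp p D (fun η => c η * (f η - cexp p {x} f η)) with hu
  set v : (V → Bool) → ℝ := cexp p D (fun η => c' η * (g₀ η - m₀ η)) with hv
  set w : (V → Bool) → ℝ := fun η => v η - cexp p {x} v η with hw
  have hcx : ∀ η ζ : V → Bool, (∀ z ∉ ({x} : Finset V), η z = ζ z) → c η = c ζ :=
    fun η ζ h => hcB η ζ fun z hz => h z fun hzx => by
      rw [Finset.mem_singleton] at hzx
      exact hxB (hzx ▸ hz)
  have hcx' : ∀ η ζ : V → Bool, (∀ z ∉ ({x} : Finset V), η z = ζ z) → c' η = c' ζ :=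
    fun η ζ h => by
      linarith [hcc η, hcc ζ, hcx η ζ h]
  have hsplit : ∀ η, cexp p D f η - m₀ η = u η + w η := by
    have e1 : cexp p D f = fun η => cexp p D (fun ζ => c ζ * f ζ) η +
        cexp p D (fun ζ => c' ζ * f ζ) η := by
      rw [← cexp_add]
      congr 1
      funext ζ
      rw [← add_mul, hcc, one_mul]
    have e2 : m₀ = fun η => cexp p {x} (cexp p D (fun ζ => c ζ * f ζ)) η +
        cexp p {x} (cexp p D (fun ζ => c' ζ * f ζ)) η := by
      rw [hm₀, Finset.insert_eq, ← cexp_cexp, e1, cexp_add]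
    have e3 : u = fun η => cexp p D (fun ζ => c ζ * f ζ) η -
        cexp p {x} (cexp p D (fun ζ => c ζ * f ζ)) η := by
      rw [hu, cexp_cexp, Finset.union_comm, ← cexp_cexp, cexp_mul_of_indep hcx, ← cexp_sub]
      simp only [mul_sub]
    have e4 : v = fun η => cexp p D (fun ζ => c' ζ * f ζ) η -
        cexp p D (fun ζ => c' ζ * m₀ ζ) η := by
      have h1 : cexp p D (fun ζ => c' ζ * f ζ) = cexp p D (fun ζ => c' ζ * g₀ ζ) := by
        have h2 : (fun ζ => c' ζ * g₀ ζ) = cexp p (D \ B) (fun ζ => c' ζ * f ζ) :=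
          (cexp_mul_of_indep (fun η ζ h => hcB' η ζ fun z hz => h z (by simp [hz])) f).symm
        rw [h2, cexp_cexp, Finset.union_eq_left.2 Finset.sdiff_subset]
      rw [h1, hv, ← cexp_sub]
      simp only [mul_sub]
    have e5 : cexp p {x} (cexp p D (fun ζ => c' ζ * m₀ ζ)) = cexp p D (fun ζ => c' ζ * m₀ ζ) := by
      rw [cexp_cexp, Finset.union_comm, ← cexp_cexp]
      congr 1
      rw [cexp_mul_of_indep hcx', hm₀, cexp_cexp]
      simp
    intro η
    simp only [hw]
    rw [e4, cexp_sub, e5, e1, e2, e3]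
    ring
  have hunorm : mean p (fun η => u η ^ 2) ≤ mean p (fun η => c η * cvar p {x} f η) := by
    refine (mean_cexp_sq_le hp0 hp1 D _).trans (le_of_eq ?_)
    rw [mean_mul_cvar hcx]
    simp only [mul_pow, hsq]
  have hvnorm : mean p (fun η => v η ^ 2) ≤ mean p c' * ∑ y ∈ insert x B, levelVar p d f y := by
    have h1 : ∀ η, v η ^ 2 ≤ mean p c' * cexp p D (fun ζ => (g₀ ζ - m₀ ζ) ^ 2) η := fun η => by
      refine (cexp_mul_sq_le hp0 hp1 D c' (fun ζ => g₀ ζ - m₀ ζ) η).trans (le_of_eq ?_)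
      simp only [hsq']
      rw [← cexp_eq_mean (p := p) hBD hcB' η]
    refine (mean_mono hp0 hp1 h1).trans ?_
    rw [mean_const_mul, mean_cexp]
    refine mul_le_mul_of_nonneg_left ?_ (mean_nonneg hp0 hp1 fun η => ?_)
    · have h2 := mean_cexp_sub_sq_le_sum_levelVar hp0 hp1 d f (insert x B) (D \ B) ?_
      · have e : insert x B ∪ D \ B = insert x D := by
          rw [Finset.insert_union, Finset.union_sdiff_of_subset hBD]
        rwa [e] at h2
      · intro y hy z hz
        rw [Finset.insert_union, Finset.union_sdiff_of_subset hBD]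
        refine Finset.mem_insert_of_mem ?_
        have : d x ≤ d y := by
          rcases Finset.mem_insert.1 hy with rfl | hy
          · exact le_rfl
          · exact (hB y hy).le
        simp only [hD, deeper, Finset.mem_filter, Finset.mem_univ, true_and]
        omega
    · rw [← hsq']; exact sq_nonneg _
  have hwnorm : mean p (fun η => w η ^ 2) ≤ mean p (fun η => v η ^ 2) := by
    have h := mean_cexp_sub_sq (p := p) (Finset.empty_subset {x}) v
    rw [cexp_empty] at h
    have := mean_nonneg hp0 hp1 (fun η => sq_nonneg (cexp p {x} v η))
    simp only [hw]
    linarith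
  have : levelVar p d f x ≤ mean p (fun η => 2 * u η ^ 2 + 2 * w η ^ 2) := by
    refine mean_mono hp0 hp1 fun η => ?_
    have := hsplit η
    rw [this]
    nlinarith [sq_nonneg (u η - w η)]
  rw [mean_add, mean_const_mul, mean_const_mul] at this
  linarith


omit hp0 hp1 in
theorem mean_indicator_true (x : V) : mean p (fun η => if η x = true then 1 else 0) = p := by
  have h := Finset.prod_univ_sum (fun _ : V => (Finset.univ : Finset Bool)) (fun y b =>
    (if y = x then (if b then p else 0) else (if b then p else 1 - p)))
  rw [Fintype.piFinset_univ] at h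
  have h2 : mean p (fun η => if η x = true then 1 else 0) = ∑ η : V → Bool, ∏ y,
      (if y = x then (if η y then p else 0) else (if η y then p else 1 - p)) := by
    refine Finset.sum_congr rfl fun η _ => ?_
    by_cases hx : η x = true
    · simp only [hx, if_true, mul_one, wt]
      refine Finset.prod_congr rfl fun y _ => ?_
      by_cases hy : y = x
      · subst hy; simp [hx]
      · simp [hy]
    · beta_reduce
      rw [if_neg hx, mul_zero, Finset.prod_eq_zero (Finset.mem_univ x)]
      simp [hx]
  rw [h2, ← h]
  rw [Finset.prod_eq_single x]
  · simp
  · intro y _ hy; simp [hy]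
  · simp

omit hp0 hp1 in
theorem mean_indicator_false (x : V) :
    mean p (fun η => if η x = true then 0 else 1) = 1 - p := by
  have h : (fun η : V → Bool => if η x = true then (0 : ℝ) else 1) =
      fun η => 1 - (if η x = true then 1 else 0) := by
    funext η; split_ifs <;> simp
  rw [h, mean_sub, mean_const, mean_indicator_true]

omit hp0 hp1 in
theorem cexp_singleton (x : V) (f : (V → Bool) → ℝ) (η : V → Bool) :
    cexp p {x} f η =
      p * f (Function.update η x true) + (1 - p) * f (Function.update η x false) := by
  have hi : ∀ b, ∀ η ζ : V → Bool, (∀ z ∉ ({x} : Finset V), η z = ζ z) →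
      f (Function.update η x b) = f (Function.update ζ x b) := fun b η ζ h => by
    congr 1
    funext z
    by_cases hz : z = x
    · subst hz; simp
    · simpa [hz] using h z (by simpa using hz)
  have h : f = fun η => f (Function.update η x true) * (if η x = true then 1 else 0) +
      f (Function.update η x false) * (if η x = true then 0 else 1) := by
    funext η
    by_cases hx : η x = true
    · have : Function.update η x true = η := by rw [← hx, Function.update_eq_self]
      simp [hx, this]
    · have : Function.update η x false = η := by
        rw [← Bool.eq_false_of_not_eq_true hx, Function.update_eq_self]
      simp [hx, this]
  conv_lhs => rw [h]
  rw [cexp_add, cexp_mul_of_indep (hi true), cexp_mul_of_indep (hi false)]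
  beta_reduce
  rw [cexp_eq_mean (B := {x}) subset_rfl (fun η ζ h => by rw [h x (by simp)]),
    cexp_eq_mean (B := {x}) subset_rfl (fun η ζ h => by rw [h x (by simp)]),
    mean_indicator_true, mean_indicator_false]
  ring

omit hp0 hp1 in
theorem cvar_singleton (x : V) (f : (V → Bool) → ℝ) (η : V → Bool) :
    cvar p {x} f η = p * (1 - p) *
      (f (Function.update η x true) - f (Function.update η x false)) ^ 2 := by
  rw [cvar, cexp_singleton, cexp_singleton]
  ring

theorem cvar_singleton_nonneg (x : V) (f : (V → Bool) → ℝ) (η : V → Bool) :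
    0 ≤ cvar p {x} f η := by
  rw [cvar_singleton]
  exact mul_nonneg (mul_nonneg hp0 (by linarith)) (sq_nonneg _)

omit hp0 hp1 in
theorem mean_update_le (hp0 : 0 < p) (hp1 : p < 1) (y : V) (b : Bool) {φ : (V → Bool) → ℝ}
    (hφ : ∀ η, 0 ≤ φ η) :
    mean p (fun η => φ (Function.update η y b)) ≤ 1 / (p * (1 - p)) * mean p φ := by
  have h1 : 0 < 1 - p := by linarith
  rw [← mean_cexp {y} φ, ← mean_const_mul]
  refine mean_mono hp0.le hp1.le fun η => ?_
  rw [cexp_singleton, one_div, ← div_eq_inv_mul, le_div_iff₀ (mul_pos hp0 h1)]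
  have ht := hφ (Function.update η y true)
  have hf := hφ (Function.update η y false)
  cases b <;> nlinarith [mul_nonneg hp0.le ht, mul_nonneg h1.le hf,
    mul_nonneg (mul_nonneg h1.le h1.le) hf, mul_nonneg (mul_nonneg hp0.le hp0.le) ht]

omit hp0 hp1 in
/-- If `A` can be reached from `A'` by emptying `y` when the constraint `c` holds, then the
Dirichlet form at `x` constrained by `A'` is controlled by the ones at `x` constrained by `A`
and at `y` constrained by `c`. -/
theorem mean_cvar_le_of_reach (hp0 : 0 < p) (hp1 : p < 1) {x y : V} (hxy : x ≠ y)
    {A A' c : (V → Bool) → Prop} (hc : ∀ η b, c η → c (Function.update η x b))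
    (h : ∀ η, A' η → A η ∨ c η ∧ A (Function.update η y false)) (f : (V → Bool) → ℝ) :
    mean p (fun η => (if A' η then 1 else 0) * cvar p {x} f η) ≤
      (1 + 6 / (p * (1 - p))) * (mean p (fun η => (if A η then 1 else 0) * cvar p {x} f η) +
        mean p (fun η => (if c η then 1 else 0) * cvar p {y} f η)) := by
  have h1 : 0 < 1 - p := by linarith
  have hn := fun z η => cvar_singleton_nonneg hp0.le hp1.le z f η
  set φ : (V → Bool) → ℝ := fun η => (if A η then 1 else 0) * cvar p {x} f η with hφ
  set ψ : (V → Bool) → ℝ := fun η => (if c η then 1 else 0) * cvar p {y} f η with hψ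
  have hφ0 : ∀ η, 0 ≤ φ η := fun η => mul_nonneg (by split_ifs <;> simp) (hn _ _)
  have hψ0 : ∀ η, 0 ≤ ψ η := fun η => mul_nonneg (by split_ifs <;> simp) (hn _ _)
  have hpt : ∀ η, (if A' η then 1 else 0) * cvar p {x} f η ≤
      φ η + (3 * φ (Function.update η y false) + (3 * ψ (Function.update η x true) +
        3 * ψ (Function.update η x false))) := by
    intro η
    have e1 := hφ0 η
    have e2 := hφ0 (Function.update η y false)
    have e3 := hψ0 (Function.update η x true)
    have e4 := hψ0 (Function.update η x false)
    by_cases hA' : A' η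
    swap
    · rw [if_neg hA', zero_mul]; positivity
    rw [if_pos hA', one_mul]
    by_cases hA : A η
    · have : φ η = cvar p {x} f η := by simp [hφ, hA]
      rw [← this]; linarith
    obtain ⟨hcη, hAy⟩ := (h η hA').resolve_left hA
    have hy : η y = true := by
      by_contra hy
      have : Function.update η y false = η := by
        rw [← Bool.eq_false_of_not_eq_true hy, Function.update_eq_self]
      exact hA (this ▸ hAy)
    have u1 : ∀ b, Function.update (Function.update η x b) y true = Function.update η x b :=
      fun b => by simp [hxy.symm, hy]
    have f2 : φ (Function.update η y false) = cvar p {x} f (Function.update η y false) := by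
      simp [hφ, hAy]
    have f3 : ∀ b, ψ (Function.update η x b) = cvar p {y} f (Function.update η x b) :=
      fun b => by simp [hψ, hc η b hcη]
    rw [f2, f3, f3] at *
    simp only [cvar_singleton, u1, Function.update_comm hxy] at *
    set a := f (Function.update η x true)
    set b := f (Function.update η x false)
    rw [Function.update_comm hxy.symm, Function.update_comm hxy.symm] 
    set a' := f (Function.update (Function.update η x true) y false)
    set b' := f (Function.update (Function.update η x false) y false)
    have key : (a - b) ^ 2 ≤ 3 * (a' - b') ^ 2 + (3 * (a - a') ^ 2 + 3 * (b - b') ^ 2) := by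
      nlinarith [sq_nonneg ((a' - b') - (a - a')), sq_nonneg ((a' - b') + (b - b')),
        sq_nonneg ((a - a') + (b - b'))]
    have := mul_le_mul_of_nonneg_left key (mul_pos hp0 h1).le
    linarith
  refine (mean_mono hp0.le hp1.le hpt).trans ?_
  rw [mean_add, mean_add, mean_add, mean_const_mul, mean_const_mul, mean_const_mul]
  have m1 := mean_update_le hp0 hp1 y false hφ0
  have m2 := mean_update_le hp0 hp1 x true hψ0
  have m3 := mean_update_le hp0 hp1 x false hψ0
  have n1 := mean_nonneg hp0.le hp1.le hφ0
  have n2 := mean_nonneg hp0.le hp1.le hψ0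
  have hK : 0 ≤ 1 / (p * (1 - p)) := by positivity
  have e : 6 / (p * (1 - p)) = 6 * (1 / (p * (1 - p))) := by ring
  rw [e]
  nlinarith [mul_nonneg hK n1, mul_nonneg hK n2]

omit hp0 hp1 in
theorem mean_prod_of_disjoint (s : Finset V) (S : V → Finset V) (F : V → (V → Bool) → ℝ)
    (hF : ∀ y ∈ s, ∀ η ζ : V → Bool, (∀ z ∈ S y, η z = ζ z) → F y η = F y ζ)
    (hS : ∀ y ∈ s, ∀ y' ∈ s, y ≠ y' → Disjoint (S y) (S y')) :
    mean p (fun η => ∏ y ∈ s, F y η) = ∏ y ∈ s, mean p (F y) := by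
  induction s using Finset.induction_on with
  | empty => simp [mean_const]
  | insert a s ha ih =>
    simp only [Finset.prod_insert ha]
    rw [← ih (fun y hy => hF y (Finset.mem_insert_of_mem hy)) fun y hy y' hy' =>
      hS y (Finset.mem_insert_of_mem hy) y' (Finset.mem_insert_of_mem hy')]
    refine mean_mul_of_disjoint (A := S a) (B := s.biUnion S) ?_
      (hF a (Finset.mem_insert_self _ _)) fun η ζ h => ?_
    · refine (Finset.disjoint_biUnion_right _ _ _).2 fun y hy => hS a (Finset.mem_insert_self _ _)
        y (Finset.mem_insert_of_mem hy) fun hay => ha (hay ▸ hy)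
    · exact Finset.prod_congr rfl fun y hy => hF y (Finset.mem_insert_of_mem hy) η ζ
        fun z hz => h z (Finset.mem_biUnion.2 ⟨y, hy, hz⟩)

omit hp0 hp1 in
/-- The binomial formula for the probability that fewer than `j` out of `k` independent
events occur. -/
theorem mean_card_lt {k j : ℕ} (hjk : j ≤ k) {q : ℝ} (s : Finset V) (hs : s.card = k)
    (S : V → Finset V) (G : V → (V → Bool) → Prop)
    (hG : ∀ y ∈ s, ∀ η ζ : V → Bool, (∀ z ∈ S y, η z = ζ z) → (G y η ↔ G y ζ))
    (hS : ∀ y ∈ s, ∀ y' ∈ s, y ≠ y' → Disjoint (S y) (S y'))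
    (hq : ∀ y ∈ s, mean p (fun η => if G y η then 0 else 1) = q) :
    mean p (fun η => if j ≤ (s.filter fun y => G y η).card then 0 else 1) = g k j 1 q := by
  have hpt : ∀ η : V → Bool, (if j ≤ (s.filter fun y => G y η).card then (0 : ℝ) else 1) =
      ∑ t ∈ s.powerset, if k - j + 1 ≤ t.card then
        ∏ y ∈ s, (if y ∈ t then (if G y η then 0 else 1) else (if G y η then 1 else 0))
        else 0 := by
    intro η
    have hcard : (s.filter fun y => G y η).card + (s.filter fun y => ¬ G y η).card = k := by
      rw [← hs]; exact Finset.card_filter_add_card_filter_not _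
    rw [Finset.sum_eq_single (s.filter fun y => ¬ G y η)]
    · rw [Finset.prod_eq_one]
      · by_cases h : j ≤ (s.filter fun y => G y η).card
        · rw [if_pos h, if_neg (by omega)]
        · rw [if_neg h, if_pos (by omega)]
      · intro y hy
        by_cases h : G y η <;> simp [h, hy]
    · intro t ht hne
      split_ifs with hc
      swap
      · rfl
      have : ∃ y ∈ s, ¬ (y ∈ t ↔ ¬ G y η) := by
        by_contra! hcon
        refine hne (Finset.ext fun y => ?_)
        rw [Finset.mem_filter]
        exact ⟨fun hy => ⟨Finset.mem_powerset.1 ht hy, (hcon y (Finset.mem_powerset.1 ht hy)).1 hy⟩,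
          fun hy => (hcon y hy.1).2 hy.2⟩
      obtain ⟨y, hy, hyt⟩ := this
      refine Finset.prod_eq_zero hy ?_
      by_cases h1 : y ∈ t <;> by_cases h2 : G y η <;> simp_all
    · intro h; exact absurd (Finset.mem_powerset.2 (Finset.filter_subset _ _)) h
  have hq' : ∀ y ∈ s, mean p (fun η => if G y η then 1 else 0) = 1 - q := fun y hy => by
    have h : (fun η : V → Bool => if G y η then (1 : ℝ) else 0) =
        fun η => 1 - (if G y η then 0 else 1) := by
      funext η; split_ifs <;> simp
    rw [h, mean_sub, mean_const, hq y hy]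
  have hterm : ∀ t ∈ s.powerset, mean p (fun η => if k - j + 1 ≤ t.card then
        ∏ y ∈ s, (if y ∈ t then (if G y η then 0 else 1) else (if G y η then 1 else 0))
        else 0) = (fun i => if k - j + 1 ≤ i then q ^ i * (1 - q) ^ (k - i) else 0) t.card := by
    intro t ht
    have hts := Finset.mem_powerset.1 ht
    by_cases hc : k - j + 1 ≤ t.card
    swap
    · simp [hc, mean_const]
    simp only [hc, if_true]
    rw [mean_prod_of_disjoint s S _ (fun y hy η ζ h => by simp only [hG y hy η ζ h]) hS]
    have : ∀ y ∈ s, mean p (fun η => if y ∈ t then (if G y η then (0 : ℝ) else 1)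
        else (if G y η then 1 else 0)) = if y ∈ t then q else 1 - q := fun y hy => by
      by_cases hyt : y ∈ t
      · simp only [hyt, if_true, hq y hy]
      · simp only [hyt, if_false, hq' y hy]
    rw [Finset.prod_congr rfl this, Finset.prod_ite, Finset.prod_const, Finset.prod_const,
      Finset.filter_mem_eq_inter, Finset.inter_eq_right.2 hts, Finset.filter_notMem_eq_sdiff,
      Finset.card_sdiff_of_subset hts, hs]
  refine (congrArg (mean p) (funext hpt)).trans ?_
  rw [mean_sum, Finset.sum_congr rfl hterm, Finset.sum_powerset_apply_card
    (fun i => if k - j + 1 ≤ i then q ^ i * (1 - q) ^ (k - i) else 0), hs, g, one_mul]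
  have e : Finset.Icc (k - j + 1) k = (Finset.range (k + 1)).filter fun i => k - j + 1 ≤ i := by
    ext i; simp; omega
  rw [e, Finset.sum_filter]
  refine Finset.sum_congr rfl fun i _ => ?_
  split_ifs <;> simp [mul_assoc]

end Averages

/-- A finite vertex set with a depth function and children sets, such that every vertex has at
most one parent and every vertex whose depth is not `n` has exactly `k` children. -/
structure RegularForest (V : Type*) (k n : ℕ) where
  /-- The depth of a vertex. -/
  depth : V → ℕ
  /-- The children of a vertex. -/
  ch : V → Finset V
  depth_of_mem_ch : ∀ {x y}, y ∈ ch x → depth y = depth x + 1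
  parent_unique : ∀ {x x' y}, y ∈ ch x → y ∈ ch x' → x = x'
  card_ch : ∀ x, (ch x).card = if depth x = n then 0 else k

namespace RegularForest

variable {V : Type*} [Fintype V] [DecidableEq V] {k n : ℕ} (T : RegularForest V k n) (j : ℕ)

/-- The constraint at `x`: either `x` is at the bottom level, or at least `j` of its children
satisfy `P`. -/
def Facilitated (P : V → (V → Bool) → Prop) (x : V) (η : V → Bool) : Prop :=
  T.depth x = n ∨ j ≤ ((T.ch x).filter fun y => P y η).card

/-- The vertex can be emptied using only vertices at most `m` levels below it. -/
def Emptiable : ℕ → V → (V → Bool) → Prop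
  | 0, x, η => η x = false
  | m + 1, x, η => η x = false ∨ T.Facilitated j (Emptiable m) x η

/-- The vertices at most `m` levels below a given one, itself included. -/
def below : ℕ → V → Finset V
  | 0, x => {x}
  | m + 1, x => insert x ((T.ch x).biUnion (below m))

/-- The vertices at least one and at most `m + 1` levels below a given one. -/
def strictlyBelow (m : ℕ) (x : V) : Finset V := (T.ch x).biUnion (T.below m)

omit [Fintype V] in
theorem depth_le_of_mem_below (m : ℕ) :
    ∀ {x z : V}, z ∈ T.below m x → z = x ∨ T.depth x < T.depth z := by
  induction m with
  | zero => intro x z h; exact Or.inl (by simpa [below] using h)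
  | succ m ih =>
    intro x z h
    rcases Finset.mem_insert.1 h with h | h
    · exact Or.inl h
    · obtain ⟨y, hy, hz⟩ := Finset.mem_biUnion.1 h
      have := T.depth_of_mem_ch hy
      rcases ih hz with rfl | h
      · right; omega
      · right; omega

omit [Fintype V] in
theorem depth_lt_of_mem_strictlyBelow {m : ℕ} {x z : V} (h : z ∈ T.strictlyBelow m x) :
    T.depth x < T.depth z := by
  obtain ⟨y, hy, hz⟩ := Finset.mem_biUnion.1 h
  have := T.depth_of_mem_ch hy
  rcases T.depth_le_of_mem_below m hz with rfl | h <;> omega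

omit [Fintype V] in
theorem eq_of_mem_below (m : ℕ) : ∀ {y y' z : V}, T.depth y = T.depth y' → z ∈ T.below m y →
    z ∈ T.below m y' → y = y' := by
  induction m with
  | zero => intro y y' z _ h h'; simp only [below, Finset.mem_singleton] at h h'; rw [← h, h']
  | succ m ih =>
    intro y y' z hd h h'
    rcases Finset.mem_insert.1 h with rfl | h
    · rcases Finset.mem_insert.1 h' with h' | h'
      · exact h'
      · have := T.depth_lt_of_mem_strictlyBelow h'
        omega
    · rcases Finset.mem_insert.1 h' with rfl | h'
      · have := T.depth_lt_of_mem_strictlyBelow h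
        omega
      · obtain ⟨w, hw, hz⟩ := Finset.mem_biUnion.1 h
        obtain ⟨w', hw', hz'⟩ := Finset.mem_biUnion.1 h'
        have e := ih (by rw [T.depth_of_mem_ch hw, T.depth_of_mem_ch hw', hd]) hz hz'
        subst e
        exact T.parent_unique hw hw'

omit [Fintype V] in
theorem disjoint_below (m : ℕ) {x y y' : V} (hy : y ∈ T.ch x) (hy' : y' ∈ T.ch x)
    (hne : y ≠ y') : Disjoint (T.below m y) (T.below m y') :=
  Finset.disjoint_left.2 fun _ hz hz' => hne (T.eq_of_mem_below m
    (by rw [T.depth_of_mem_ch hy, T.depth_of_mem_ch hy']) hz hz')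

theorem sum_sum_ch_le {Q : V → ℝ} (hQ : ∀ y, 0 ≤ Q y) : ∑ x, ∑ y ∈ T.ch x, Q y ≤ ∑ y, Q y := by
  rw [← Finset.sum_biUnion]
  · exact Finset.sum_le_univ_sum_of_nonneg hQ
  · intro x _ x' _ hne
    exact Finset.disjoint_left.2 fun y hy hy' => hne (T.parent_unique hy hy')

theorem sum_sum_below_le {Q : V → ℝ} (hQ : ∀ y, 0 ≤ Q y) (m : ℕ) :
    ∑ x, ∑ y ∈ T.below m x, Q y ≤ (m + 1) * ∑ y, Q y := by
  induction m with
  | zero => simp [below]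
  | succ m ih =>
    have h1 : ∀ x, ∑ y ∈ T.below (m + 1) x, Q y ≤
        Q x + ∑ y ∈ T.ch x, ∑ z ∈ T.below m y, Q z := fun x => by
      have hx : x ∉ (T.ch x).biUnion (T.below m) := fun h =>
        lt_irrefl _ (T.depth_lt_of_mem_strictlyBelow h)
      rw [below, Finset.sum_insert hx, Finset.sum_biUnion]
      exact fun y hy y' hy' hne => T.disjoint_below m hy hy' hne
    refine (Finset.sum_le_sum fun x _ => h1 x).trans ?_
    rw [Finset.sum_add_distrib]
    have h2 := T.sum_sum_ch_le (Q := fun y => ∑ z ∈ T.below m y, Q z)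
      fun y => Finset.sum_nonneg fun z _ => hQ z
    push_cast
    linarith

omit [Fintype V] [DecidableEq V] in
theorem facilitated_mono {P P' : V → (V → Bool) → Prop} {x : V} {η ζ : V → Bool}
    (h : ∀ y ∈ T.ch x, P y η → P' y ζ) (hP : T.Facilitated j P x η) : T.Facilitated j P' x ζ :=
  hP.imp_right fun hc => hc.trans (Finset.card_le_card fun y hy => by
    rw [Finset.mem_filter] at hy ⊢
    exact ⟨hy.1, h y hy.1 hy.2⟩)

omit [Fintype V] [DecidableEq V] in
theorem facilitated_congr {P P' : V → (V → Bool) → Prop} {x : V} {η ζ : V → Bool}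
    (h : ∀ y ∈ T.ch x, (P y η ↔ P' y ζ)) : T.Facilitated j P x η ↔ T.Facilitated j P' x ζ :=
  ⟨T.facilitated_mono j fun y hy => (h y hy).1, T.facilitated_mono j fun y hy => (h y hy).2⟩

omit [Fintype V] in
theorem emptiable_congr (m : ℕ) : ∀ {x : V} {η ζ : V → Bool},
    (∀ z ∈ T.below m x, η z = ζ z) → (T.Emptiable j m x η ↔ T.Emptiable j m x ζ) := by
  induction m with
  | zero => intro x η ζ h; rw [Emptiable, Emptiable, h x (by simp [below])]
  | succ m ih =>
    intro x η ζ h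
    rw [Emptiable, Emptiable, h x (by simp [below]), T.facilitated_congr j fun y hy => ih fun z hz =>
      h z (Finset.mem_insert_of_mem (Finset.mem_biUnion.2 ⟨y, hy, hz⟩))]

omit [Fintype V] in
theorem facilitated_emptiable_congr {m : ℕ} {x : V} {η ζ : V → Bool}
    (h : ∀ z ∈ T.strictlyBelow m x, η z = ζ z) :
    T.Facilitated j (T.Emptiable j m) x η ↔ T.Facilitated j (T.Emptiable j m) x ζ :=
  T.facilitated_congr j fun y hy => T.emptiable_congr j m fun z hz =>
    h z (Finset.mem_biUnion.2 ⟨y, hy, hz⟩)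

omit [Fintype V] in
theorem facilitated_emptiable_update {m : ℕ} {x z : V} (hz : T.depth z ≤ T.depth x)
    (η : V → Bool) (b : Bool) : T.Facilitated j (T.Emptiable j m) x (Function.update η z b) ↔
      T.Facilitated j (T.Emptiable j m) x η :=
  T.facilitated_emptiable_congr j fun w hw => by
    have := T.depth_lt_of_mem_strictlyBelow hw
    exact Function.update_of_ne (fun h => by subst h; omega) _ _

variable {j} {p : ℝ}

/-- The probability that a vertex at depth `i` is not `Emptiable` within `m` levels. -/
def failProb (k n j : ℕ) (p : ℝ) : ℕ → ℕ → ℝ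
  | 0, _ => p
  | m + 1, i => if i = n then 0 else g k j p (failProb k n j p m (i + 1))

theorem mean_not_facilitated (hjk : j ≤ k) {m : ℕ}
    (hm : ∀ y, mean p (fun η => if T.Emptiable j m y η then 0 else 1) =
      failProb k n j p m (T.depth y)) (x : V) :
    mean p (fun η => if T.Facilitated j (T.Emptiable j m) x η then 0 else 1) =
      if T.depth x = n then 0 else g k j 1 (failProb k n j p m (T.depth x + 1)) := by
  by_cases hx : T.depth x = n
  · simp [Facilitated, hx, mean_const]
  · simp only [Facilitated, hx, false_or, if_false]
    refine mean_card_lt hjk (T.ch x) (by rw [T.card_ch, if_neg hx]) (T.below m) _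
      (fun y _ η ζ h => T.emptiable_congr j m h)
      (fun y hy y' hy' hne => T.disjoint_below m hy hy' hne) fun y hy => ?_
    rw [hm, T.depth_of_mem_ch hy]

theorem mean_not_emptiable (hjk : j ≤ k) (m : ℕ) (x : V) :
    mean p (fun η => if T.Emptiable j m x η then 0 else 1) =
      failProb k n j p m (T.depth x) := by
  induction m generalizing x with
  | zero =>
    rw [failProb]
    refine Eq.trans ?_ (mean_indicator_true (p := p) x)
    congr 1
    funext η
    cases h : η x <;> simp [Emptiable, h]
  | succ m ih =>
    have h1 : (fun η => if T.Emptiable j (m + 1) x η then (0 : ℝ) else 1) = fun η =>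
        (if η x = true then 1 else 0) *
        (if T.Facilitated j (T.Emptiable j m) x η then 0 else 1) := by
      funext η
      by_cases h : T.Facilitated j (T.Emptiable j m) x η <;> cases hx : η x <;>
        simp [Emptiable, h, hx]
    rw [h1, mean_mul_of_disjoint (A := {x}) (B := T.strictlyBelow m x),
      mean_indicator_true, T.mean_not_facilitated hjk ih, failProb]
    · split_ifs
      · simp
      · simp [g]
    · exact Finset.disjoint_singleton_left.2 fun h =>
        lt_irrefl _ (T.depth_lt_of_mem_strictlyBelow h)
    · intro η ζ h; rw [h x (by simp)]
    · intro η ζ h; simp only [T.facilitated_emptiable_congr j h]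

theorem failProb_mem (hp0 : 0 < p) (hp1 : p < 1) {r : ℝ} (hr0 : 0 ≤ r) (hr1 : r < 1)
    (hr : ∀ x ∈ Set.Icc (0 : ℝ) 1, g k j p x ≤ r * x) (m i : ℕ) :
    failProb k n j p m i ∈ Set.Icc 0 (r ^ m) := by
  induction m generalizing i with
  | zero => simp [failProb, hp0.le, hp1.le]
  | succ m ih =>
    rw [failProb]
    split_ifs
    · exact ⟨le_rfl, by positivity⟩
    · obtain ⟨h0, h1⟩ := ih (i + 1)
      have h2 : failProb k n j p m (i + 1) ≤ 1 := h1.trans (pow_le_one₀ hr0 hr1.le)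
      constructor
      · refine mul_nonneg hp0.le (Finset.sum_nonneg fun i _ => ?_)
        have := sub_nonneg.2 h2
        positivity
      · refine (hr _ ⟨h0, h2⟩).trans ?_
        rw [pow_succ']
        exact mul_le_mul_of_nonneg_left h1 hr0

theorem mean_not_facilitated_le (hjk : j ≤ k) (hp0 : 0 < p) (hp1 : p < 1) {r : ℝ} (hr0 : 0 ≤ r)
    (hr1 : r < 1) (hr : ∀ x ∈ Set.Icc (0 : ℝ) 1, g k j p x ≤ r * x) (m : ℕ) (x : V) :
    mean p (fun η => if T.Facilitated j (T.Emptiable j m) x η then 0 else 1) ≤ r ^ m / p := by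
  rw [T.mean_not_facilitated hjk (T.mean_not_emptiable hjk m)]
  split_ifs
  · positivity
  · obtain ⟨h0, h1⟩ := failProb_mem (n := n) hp0 hp1 hr0 hr1 hr m (T.depth x + 1)
    have h2 := hr _ ⟨h0, h1.trans (pow_le_one₀ hr0 hr1.le)⟩
    rw [le_div_iff₀ hp0]
    have e : g k j p (failProb k n j p m (T.depth x + 1)) =
      g k j 1 (failProb k n j p m (T.depth x + 1)) * p := by simp [g, mul_comm]
    rw [← e]
    nlinarith

/-- The Dirichlet form at `x` constrained to the configurations for which `x` can be flipped
after emptying vertices at most `m` levels below its children. -/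
def localForm (j : ℕ) (p : ℝ) (m : ℕ) (f : (V → Bool) → ℝ) (x : V) : ℝ :=
  mean p (fun η => (if T.Facilitated j (T.Emptiable j m) x η then 1 else 0) * cvar p {x} f η)

theorem localForm_nonneg (hp0 : 0 < p) (hp1 : p < 1) (m : ℕ) (f : (V → Bool) → ℝ) (x : V) :
    0 ≤ T.localForm j p m f x :=
  mean_nonneg hp0.le hp1.le fun η => mul_nonneg (by split_ifs <;> simp)
    (cvar_singleton_nonneg hp0.le hp1.le x f η)

theorem localForm_succ_le (hp0 : 0 < p) (hp1 : p < 1) (m : ℕ) (f : (V → Bool) → ℝ) (x : V) :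
    T.localForm j p (m + 1) f x ≤ (1 + 6 / (p * (1 - p))) ^ k *
      (T.localForm j p 0 f x + ∑ y ∈ T.ch x, T.localForm j p m f y) := by
  have hp1' : 0 < 1 - p := by linarith
  set K := 1 + 6 / (p * (1 - p)) with hK
  have hK1 : 1 ≤ K := by
    have : 0 ≤ 6 / (p * (1 - p)) := by positivity
    linarith
  have hn := fun m y => T.localForm_nonneg (j := j) hp0 hp1 m f y
  have main : ∀ s ⊆ T.ch x, mean p (fun η => (if T.Facilitated j (fun y η => η y = false ∨
      y ∈ s ∧ T.Facilitated j (T.Emptiable j m) y η) x η then 1 else 0) * cvar p {x} f η) ≤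
      K ^ s.card * (T.localForm j p 0 f x + ∑ y ∈ s, T.localForm j p m f y) := by
    intro s
    induction s using Finset.induction_on with
    | empty =>
      intro _
      rw [Finset.card_empty, pow_zero, one_mul, Finset.sum_empty, add_zero, localForm]
      have hiff : ∀ η, T.Facilitated j (fun y η => η y = false ∨
          y ∈ (∅ : Finset V) ∧ T.Facilitated j (T.Emptiable j m) y η) x η ↔
          T.Facilitated j (T.Emptiable j 0) x η := fun η =>
        T.facilitated_congr j fun y _ => by simp [Emptiable]
      simp only [hiff, le_refl]
    | insert y s hy ih =>
      intro hs
      have hyx : y ∈ T.ch x := hs (Finset.mem_insert_self _ _)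
      have hdy := T.depth_of_mem_ch hyx
      have hne : x ≠ y := fun h => by subst h; omega
      refine (mean_cvar_le_of_reach hp0 hp1 hne
        (A := T.Facilitated j (fun y η => η y = false ∨
          y ∈ s ∧ T.Facilitated j (T.Emptiable j m) y η) x)
        (c := T.Facilitated j (T.Emptiable j m) y)
        (fun η b h => (T.facilitated_emptiable_update j (by omega) η b).2 h) ?_ f).trans ?_
      · intro η h
        by_cases hc : T.Facilitated j (T.Emptiable j m) y η
        · refine Or.inr ⟨hc, T.facilitated_mono j (fun z hz hP => ?_) h⟩
          by_cases hzy : z = y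
          · subst hzy; simp
          · rw [Function.update_of_ne hzy, T.facilitated_emptiable_update j
              (by rw [hdy, T.depth_of_mem_ch hz])]
            simpa [hzy] using hP
        · refine Or.inl (T.facilitated_mono j (fun z _ hP => hP.imp_right fun hP => ⟨?_, hP.2⟩) h)
          rcases Finset.mem_insert.1 hP.1 with rfl | h1
          · exact absurd hP.2 hc
          · exact h1
      · have h1 := ih fun z hz => hs (Finset.mem_insert_of_mem hz)
        rw [Finset.card_insert_of_notMem hy, pow_succ', mul_assoc, Finset.sum_insert hy]
        refine mul_le_mul_of_nonneg_left ?_ (by linarith)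
        have h2 : T.localForm j p m f y ≤ K ^ s.card * T.localForm j p m f y :=
          le_mul_of_one_le_left (hn m y) (one_le_pow₀ hK1)
        simp only [localForm] at h1 h2 ⊢
        linarith
  have h := main (T.ch x) subset_rfl
  have e : T.localForm j p (m + 1) f x = mean p (fun η => (if T.Facilitated j (fun y η =>
      η y = false ∨ y ∈ T.ch x ∧ T.Facilitated j (T.Emptiable j m) y η) x η then 1 else 0) *
      cvar p {x} f η) := by
    rw [localForm]
    congr 1
    funext η
    have : T.Facilitated j (T.Emptiable j (m + 1)) x η ↔ T.Facilitated j (fun y η =>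
        η y = false ∨ y ∈ T.ch x ∧ T.Facilitated j (T.Emptiable j m) y η) x η :=
      T.facilitated_congr j fun y hy => by simp [Emptiable, hy]
    simp only [this]
  rw [e]
  refine h.trans (mul_le_mul_of_nonneg_right (pow_le_pow_right₀ hK1 ?_)
    (add_nonneg (hn _ _) (Finset.sum_nonneg fun y _ => hn _ _)))
  rw [T.card_ch]
  split_ifs <;> simp

theorem sum_localForm_le (hp0 : 0 < p) (hp1 : p < 1) (m : ℕ) (f : (V → Bool) → ℝ) :
    ∑ x, T.localForm j p m f x ≤
      (2 * (1 + 6 / (p * (1 - p))) ^ k) ^ m * ∑ x, T.localForm j p 0 f x := by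
  have hp1' : 0 < 1 - p := by linarith
  have hL : 1 ≤ (1 + 6 / (p * (1 - p))) ^ k := one_le_pow₀ (by
    have : 0 ≤ 6 / (p * (1 - p)) := by positivity
    linarith)
  have hn := fun m y => T.localForm_nonneg (j := j) hp0 hp1 m f y
  induction m with
  | zero => simp
  | succ m ih =>
    refine (Finset.sum_le_sum fun x _ => T.localForm_succ_le hp0 hp1 m f x).trans ?_
    rw [← Finset.mul_sum, Finset.sum_add_distrib]
    have h1 := T.sum_sum_ch_le (hn m)
    have h2 : 0 ≤ ∑ x, T.localForm j p 0 f x := Finset.sum_nonneg fun x _ => hn 0 x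
    set L := (1 + 6 / (p * (1 - p))) ^ k
    have h3 := le_mul_of_one_le_left h2 (one_le_pow₀ (n := m) (by linarith : 1 ≤ 2 * L))
    rw [pow_succ', mul_assoc, mul_assoc, mul_left_comm]
    refine mul_le_mul_of_nonneg_left ?_ (by linarith)
    linarith

theorem varTot_le (hjk : j ≤ k) (hp0 : 0 < p) (hp1 : p < 1) {r : ℝ} (hr0 : 0 ≤ r)
    (hr1 : r < 1) (hr : ∀ x ∈ Set.Icc (0 : ℝ) 1, g k j p x ≤ r * x) {m : ℕ}
    (hm : 4 * (r ^ m / p) * (m + 2) ≤ 1) (f : (V → Bool) → ℝ) :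
    varTot p f ≤ 4 * (2 * (1 + 6 / (p * (1 - p))) ^ k) ^ m * ∑ x, T.localForm j p 0 f x := by
  have hQ : ∀ y, 0 ≤ levelVar p T.depth f y := fun y =>
    mean_nonneg hp0.le hp1.le fun η => sq_nonneg _
  have h1 : ∀ x, levelVar p T.depth f x ≤ 2 * T.localForm j p m f x +
      2 * (r ^ m / p) * ∑ y ∈ T.below (m + 1) x, levelVar p T.depth f y := fun x => by
    refine (levelVar_le hp0.le hp1.le T.depth f x (T.strictlyBelow m x)
      (fun z hz => T.depth_lt_of_mem_strictlyBelow hz) (T.Facilitated j (T.Emptiable j m) x)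
      fun η ζ h => T.facilitated_emptiable_congr j h).trans ?_
    refine add_le_add_right (mul_le_mul_of_nonneg_right (mul_le_mul_of_nonneg_left
      (T.mean_not_facilitated_le hjk hp0 hp1 hr0 hr1 hr m x) zero_le_two)
      (Finset.sum_nonneg fun y _ => hQ y)) _
  have h2 := Finset.sum_le_sum fun x (_ : x ∈ Finset.univ) => h1 x
  rw [Finset.sum_add_distrib, ← Finset.mul_sum, ← Finset.mul_sum] at h2
  have h3 := T.sum_sum_below_le hQ (m + 1)
  have h4 := varTot_le_sum_levelVar hp0.le hp1.le T.depth f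
  have h5 := T.sum_localForm_le (j := j) hp0 hp1 m f
  have h6 : 0 ≤ ∑ y, levelVar p T.depth f y := Finset.sum_nonneg fun y _ => hQ y
  push_cast at h3
  have h7 := mul_le_mul_of_nonneg_left h3 (by positivity : 0 ≤ 2 * (r ^ m / p))
  have h8 := mul_le_mul_of_nonneg_right hm h6
  linarith

end RegularForest

theorem g_one_right {k j : ℕ} (hj : 1 ≤ j) (hjk : j ≤ k) (p : ℝ) : g k j p 1 = p := by
  rw [g, Finset.sum_eq_single k]
  · simp
  · intro i hi hne
    have : k - i ≠ 0 := by have := (Finset.mem_Icc.1 hi).2; omega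
    simp [this]
  · intro h
    rw [Finset.mem_Icc] at h
    omega

theorem g_zero_right (k j : ℕ) (p : ℝ) : g k j p 0 = 0 := by
  rw [g, Finset.sum_eq_zero, mul_zero]
  intro i hi
  have : i ≠ 0 := by have := (Finset.mem_Icc.1 hi).1; omega
  simp [this]

/-- Below the critical density the recursion map is a linear contraction towards `0`. -/
theorem exists_g_le_mul {k j : ℕ} (hj : 1 ≤ j) (hjk : j ≤ k) {p : ℝ} (hp0 : 0 < p)
    (hp : p < ptilde k j) :
    p < 1 ∧ ∃ r : ℝ, 0 ≤ r ∧ r < 1 ∧ ∀ x ∈ Set.Icc (0 : ℝ) 1, g k j p x ≤ r * x := by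
  have hne : {p : ℝ | p ∈ Set.Icc (0 : ℝ) 1 ∧
      ∀ x ∈ Set.Icc (0 : ℝ) 1, g k j p x = x → x = 0}.Nonempty :=
    ⟨0, ⟨le_rfl, zero_le_one⟩, fun x _ h => by simpa [g] using h.symm⟩
  obtain ⟨p', ⟨⟨h0, h1⟩, hfix⟩, hpp'⟩ := exists_lt_of_lt_csSup hne hp
  have hp'1 : p' < 1 := by
    refine lt_of_le_of_ne h1 fun h => ?_
    have := hfix 1 ⟨zero_le_one, le_rfl⟩ (by rw [g_one_right hj hjk, h])
    norm_num at this
  have hp'0 : 0 < p' := hp0.trans hpp'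
  refine ⟨hpp'.trans hp'1, p / p', by positivity, (div_lt_one hp'0).2 hpp', fun x hx => ?_⟩
  have key : g k j p' x ≤ x := by
    by_contra! hlt
    have hcont : ContinuousOn (fun t => g k j p' t - t) (Set.Icc x 1) := by
      unfold g
      fun_prop
    have hmem : (0 : ℝ) ∈ Set.Icc (g k j p' 1 - 1) (g k j p' x - x) := by
      rw [g_one_right hj hjk]
      constructor <;> linarith
    obtain ⟨t, ht, ht0⟩ := intermediate_value_Icc' hx.2 hcont hmem
    have := hfix t ⟨hx.1.trans ht.1, ht.2⟩ (sub_eq_zero.1 ht0)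
    have hx0 : x = 0 := le_antisymm (this ▸ ht.1) hx.1
    rw [hx0, g_zero_right] at hlt
    exact lt_irrefl _ hlt
  have e : g k j p x = p / p' * g k j p' x := by
    unfold g
    field_simp
  rw [e]
  exact mul_le_mul_of_nonneg_left key (by positivity)

theorem exists_mul_pow_le {p r : ℝ} (hr0 : 0 ≤ r) (hr1 : r < 1) :
    ∃ m : ℕ, 4 * (r ^ m / p) * (m + 2) ≤ 1 := by
  have h1 := tendsto_self_mul_const_pow_of_lt_one hr0 hr1
  have h2 := tendsto_pow_atTop_nhds_zero_of_lt_one hr0 hr1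
  have h3 := (h1.add (h2.const_mul 2)).const_mul (4 / p)
  simp only [mul_zero, add_zero] at h3
  obtain ⟨m, hm⟩ := (h3.eventually (gt_mem_nhds one_pos)).exists
  refine ⟨m, le_trans (le_of_eq ?_) hm.le⟩
  ring

theorem childOf_iff_exists_snoc {k n : ℕ} (m : ℕ) (hm : m < n + 1) (hm' : m + 1 < n + 1)
    (w : Fin m → Fin k) (y : TV k n) :
    childOf ⟨⟨m, hm⟩, w⟩ y ↔
      ∃ a : Fin k, (⟨⟨m + 1, hm'⟩, Fin.snoc w a⟩ : TV k n) = y := by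
  obtain ⟨⟨l, hl⟩, v⟩ := y
  constructor
  · rintro ⟨h, hv⟩
    dsimp only at h
    subst h
    refine ⟨v (Fin.last m), ?_⟩
    congr 1
    funext i
    refine Fin.lastCases ?_ (fun i => ?_) i
    · simp
    · simpa using (hv i).symm
  · rintro ⟨a, ha⟩
    rw [← ha]
    exact ⟨rfl, fun i => by simp⟩

/-- The rooted `k`-ary tree of depth `n` as a regular forest. -/
def treeForest (k n : ℕ) : RegularForest (TV k n) k n where
  depth x := x.1.val
  ch x := Finset.univ.filter fun y => childOf x y
  depth_of_mem_ch h := (Finset.mem_filter.1 h).2.1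
  parent_unique := by
    rintro ⟨⟨l, hl⟩, v⟩ ⟨⟨l', hl'⟩, v'⟩ y h h'
    obtain ⟨e, hv⟩ := (Finset.mem_filter.1 h).2
    obtain ⟨e', hv'⟩ := (Finset.mem_filter.1 h').2
    dsimp only at e e'
    have : l = l' := by omega
    subst this
    congr 1
    funext i
    exact (hv i).symm.trans (hv' i)
  card_ch := by
    rintro ⟨⟨m, hm⟩, w⟩
    dsimp only
    split_ifs with h
    · rw [Finset.card_eq_zero, Finset.filter_eq_empty_iff]
      rintro ⟨⟨l, hl⟩, v⟩ - ⟨e, -⟩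
      dsimp only at e
      omega
    · have hm' : m + 1 < n + 1 := by omega
      have e : (Finset.univ.filter fun y : TV k n => childOf ⟨⟨m, hm⟩, w⟩ y) =
          Finset.univ.image fun a : Fin k => (⟨⟨m + 1, hm'⟩, Fin.snoc w a⟩ : TV k n) := by
        ext y
        simp [childOf_iff_exists_snoc m hm hm']
      rw [e, Finset.card_image_of_injective, Finset.card_univ, Fintype.card_fin]
      intro a b hab
      have := eq_of_heq (Sigma.mk.inj hab).2
      simpa using congrFun this (Fin.last m)

theorem localForm_treeForest (k n j : ℕ) (p : ℝ) (f : (TV k n → Bool) → ℝ) (x : TV k n) :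
    (treeForest k n).localForm j p 0 f x =
      mean p (fun η => cbar j x η * cvar p {x} f η) := by
  have e : ∀ η : TV k n → Bool,
      ((treeForest k n).ch x).filter (fun y => (treeForest k n).Emptiable j 0 y η) =
        Finset.univ.filter fun y => childOf x y ∧ η y = false := fun η => by
    ext y
    rw [Finset.mem_filter, Finset.mem_filter]
    simp [treeForest, RegularForest.Emptiable]
  have hd : (treeForest k n).depth x = x.1.val := rfl
  rw [RegularForest.localForm]
  congr 1
  funext η
  congr 1
  simp only [RegularForest.Facilitated, e, hd, cbar]
  by_cases h : x.1.val = n <;> simp [h]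

theorem oriented_FA_poincare (k j : ℕ) (p : ℝ) (hk : 2 ≤ k) (hj : 2 ≤ j) (hjk : j ≤ k)
    (hp0 : 0 < p) (hp : p < ptilde k j) :
    ∃ lam : ℝ, 1 ≤ lam ∧ ∀ (n : ℕ) (f : (TV k n → Bool) → ℝ),
      varTot p f ≤ lam * ∑ x : TV k n, mean p (fun η => cbar j x η * cvar p {x} f η) := by
  obtain ⟨hp1, r, hr0, hr1, hr⟩ := exists_g_le_mul (by omega) hjk hp0 hp
  obtain ⟨m, hm⟩ := exists_mul_pow_le (p := p) hr0 hr1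
  have hp1' : 0 < 1 - p := by linarith
  have hL : 1 ≤ (1 + 6 / (p * (1 - p))) ^ k := one_le_pow₀ (by
    have : 0 ≤ 6 / (p * (1 - p)) := by positivity
    linarith)
  refine ⟨4 * (2 * (1 + 6 / (p * (1 - p))) ^ k) ^ m, ?_, fun n f => ?_⟩
  · have := one_le_pow₀ (n := m) (by linarith : 1 ≤ 2 * (1 + 6 / (p * (1 - p))) ^ k)
    linarith
  · have h := (treeForest k n).varTot_le hjk hp0 hp1 hr0 hr1 hr hm f
    simpa only [localForm_treeForest] using h
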